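/- Every binary word of length 2 is tilde-isometric. -/

import Mathlib

/-- One tilde edit step: a replacement (flip one symbol) or a swap of two
adjacent distinct symbols. -/
inductive TStep : List Bool → List Bool → Prop
  | repl (x y : List Bool) (a : Bool) : TStep (x ++ a :: y) (x ++ (!a) :: y)
  | swap (x y : List Bool) (a : Bool) : TStep (x ++ a :: (!a) :: y) (x ++ (!a) :: a :: y)

/-- `reach step h u v` : `v` can be obtained from `u` by a chain of `h` steps. -/
def reach (step : List Bool → List Bool → Prop) : ℕ → List Bool → List Bool → Prop
  | 0 => Eq
  | h + 1 => fun u v => ∃ w, step u w ∧ reach step h w v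

/-- The tilde-distance: the minimum number of replacements and swaps needed to
transform `u` into `v`. -/
noncomputable def tildeDist (u v : List Bool) : ℕ := sInf {h | reach TStep h u v}

theorem TStep.symm {u v : List Bool} (h : TStep u v) : TStep v u := by
  cases h with
  | repl x y a => simpa using TStep.repl x y (!a)
  | swap x y a => simpa using TStep.swap x y (!a)

theorem reach_snoc {step : List Bool → List Bool → Prop} :
    ∀ {h : ℕ} {u v w : List Bool}, reach step h u v → step v w → reach step (h + 1) u w := by
  intro h
  induction h with
  | zero => intro u v w r s; exact ⟨w, r ▸ s, rfl⟩
  | succ h ih => intro u v w r s; obtain ⟨z, su, rz⟩ := r; exact ⟨z, su, ih rz s⟩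

theorem reach_symm : ∀ {h : ℕ} {u v : List Bool}, reach TStep h u v → reach TStep h v u := by
  intro h
  induction h with
  | zero => intro u v r; exact r.symm
  | succ h ih => intro u v r; obtain ⟨w, s, rw⟩ := r; exact reach_snoc (ih rw) s.symm

theorem tildeDist_comm (u v : List Bool) : tildeDist u v = tildeDist v u := by
  unfold tildeDist
  congr 1
  ext h
  exact ⟨fun r => reach_symm r, fun r => reach_symm r⟩

theorem tildeDist_self (u : List Bool) : tildeDist u u = 0 :=
  Nat.sInf_eq_zero.mpr (Or.inl rfl)

/-- The Hamming distance: the number of positions at which `u` and `v` differ. -/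
def hammDist (u v : List Bool) : ℕ := ((u.zip v).filter fun p => p.1 != p.2).length

theorem hammDist_comm : ∀ u v : List Bool, hammDist u v = hammDist v u
  | [], [] => rfl
  | [], _ :: _ => rfl
  | _ :: _, [] => rfl
  | a :: u, b :: v => by
    cases a <;> cases b <;>
      simp [hammDist, List.filter_cons, hammDist_comm u v, hammDist] <;>
      simpa [hammDist] using hammDist_comm u v

theorem hammDist_self : ∀ u : List Bool, hammDist u u = 0
  | [] => rfl
  | a :: u => by simpa [hammDist, List.filter_cons] using hammDist_self u

/-- Binary words of length `n`. -/
abbrev Word (n : ℕ) := {w : List Bool // w.length = n}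

/-- The `n`-tilde-hypercube: vertices are the binary words of length `n`, and
two vertices are adjacent iff their tilde-distance is `1`. -/
noncomputable def tildeCube (n : ℕ) : SimpleGraph (Word n) where
  Adj u v := tildeDist u.val v.val = 1
  symm := by constructor; intro u v h; rwa [tildeDist_comm]
  loopless := by constructor; intro u h; rw [tildeDist_self] at h; exact one_ne_zero h.symm

/-- The `n`-hypercube: vertices are the binary words of length `n`, and
two vertices are adjacent iff their Hamming distance is `1`. -/
def hamCube (n : ℕ) : SimpleGraph (Word n) where
  Adj u v := hammDist u.val v.val = 1
  symm := by constructor; intro u v h; rwa [hammDist_comm]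
  loopless := by constructor; intro u h; rw [hammDist_self] at h; exact one_ne_zero h.symm

/-- `f` is tilde-isometric. -/
def TildeIsometric (f : List Bool) : Prop :=
  ∀ n : ℕ, f.length ≤ n → ∀ u v : List Bool, u.length = n → v.length = n →
    ¬ f <:+: u → ¬ f <:+: v →
    ∃ w : ℕ → List Bool, w 0 = u ∧ w (tildeDist u v) = v ∧
      (∀ k < tildeDist u v, tildeDist (w k) (w (k + 1)) = 1) ∧
      (∀ k ≤ tildeDist u v, ¬ f <:+: w k)

/-- `f` is Ham-isometric. -/
def HamIsometric (f : List Bool) : Prop :=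
  ∀ u v : List Bool, u.length = v.length →
    ¬ f <:+: u → ¬ f <:+: v →
    ∃ w : ℕ → List Bool, w 0 = u ∧ w (hammDist u v) = v ∧
      (∀ k ≤ hammDist u v, (w k).length = u.length) ∧
      (∀ k < hammDist u v, hammDist (w k) (w (k + 1)) = 1) ∧
      (∀ k ≤ hammDist u v, ¬ f <:+: w k)
/-- The set of words of length `n` avoiding the factor `11`. -/
def fibFree (n : ℕ) : Set (Word n) := {w | ¬ [true, true] <:+: w.val}

/-- The `n`-tilde-Fibonacci cube: the subgraph of the tilde-hypercube induced by
the words avoiding the factor `11`. -/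
noncomputable def tildeFibCube (n : ℕ) : SimpleGraph (fibFree n) :=
  (tildeCube n).induce (fibFree n)

/-- The `n`-Fibonacci cube: the subgraph of the hypercube induced by
the words avoiding the factor `11`. -/
def fibCube (n : ℕ) : SimpleGraph (fibFree n) :=
  (hamCube n).induce (fibFree n)

/-- Greedy cost with a pending letter. -/
def gE : Option Bool → List Bool → List Bool → ℕ
  | _, [], _ => 0
  | _, _ :: _, [] => 0
  | s, a :: u, c :: v =>
    if a = c then gE none u v
    else if s = some (!a) then gE none u v else 1 + gE (some a) u v

theorem gE_swap : ∀ (u v : List Bool) (s : Option Bool),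
    gE (s.map not) v u = gE s u v
  | [], [], s => by simp [gE]
  | [], _ :: _, s => by simp [gE]
  | _ :: _, [], s => by simp [gE]
  | a :: u, c :: v, s => by
    have h0 := gE_swap u v none
    have h1 := gE_swap u v (some true)
    have h2 := gE_swap u v (some false)
    simp at h0 h1 h2
    rcases s with _ | s
    · cases a <;> cases c <;> simp [gE, h0, h1, h2]
    · cases s <;> cases a <;> cases c <;> simp [gE, h0, h1, h2]

theorem gE_symm (u v : List Bool) : gE none v u = gE none u v := gE_swap u v none

theorem gE_bounds : ∀ (u v : List Bool) (s : Option Bool),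
    gE s u v ≤ gE none u v ∧ gE none u v ≤ gE s u v + 1
  | [], v, s => by simp [gE]
  | _ :: _, [], s => by simp [gE]
  | a :: u, c :: v, s => by
    have h1 := gE_bounds u v (some a)
    simp only [gE]
    split_ifs <;> simp_all <;> omega

theorem gE_self : ∀ (u : List Bool) (s : Option Bool), gE s u u = 0
  | [], s => by simp [gE]
  | a :: u, s => by simp [gE, gE_self u]

theorem gE_append (p u v : List Bool) : gE none (p ++ u) (p ++ v) = gE none u v := by
  induction p with
  | nil => rfl
  | cons a p ih => simp [gE, ih]

theorem gE_lip_cons {u w : List Bool} (a : Bool)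
    (h : ∀ s v, gE s u v ≤ gE s w v + 1) (s : Option Bool) (v : List Bool) :
    gE s (a :: u) v ≤ gE s (a :: w) v + 1 := by
  cases v with
  | nil => simp [gE]
  | cons c v =>
    have h0 := h none v
    have h1 := h (some a) v
    simp only [gE]
    split_ifs <;> omega

theorem gE_lip {u w : List Bool} (h : TStep u w) :
    ∀ s v, gE s u v ≤ gE s w v + 1 := by
  cases h with
  | repl x y a =>
    induction x with
    | nil =>
      intro s v
      cases v with
      | nil => simp [gE]
      | cons c v =>
        have h0 := gE_bounds y v (some true)
        have h1 := gE_bounds y v (some false)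
        rcases s with _ | s
        · cases a <;> cases c <;> simp [gE] <;> omega
        · cases s <;> cases a <;> cases c <;> simp [gE] <;> omega
    | cons b x ih => exact gE_lip_cons b ih
  | swap x y a =>
    induction x with
    | nil =>
      intro s v
      rcases v with _ | ⟨c, _ | ⟨d, v⟩⟩
      · simp [gE]
      · simp only [gE, List.nil_append]
        split_ifs <;> omega
      · have h0 := gE_bounds y v (some true)
        have h1 := gE_bounds y v (some false)
        rcases s with _ | s
        · cases a <;> cases c <;> cases d <;> simp [gE] <;> omega
        · cases s <;> cases a <;> cases c <;> cases d <;> simp [gE] <;> omega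
    | cons b x ih => exact gE_lip_cons b ih

theorem gE_le_of_reach : ∀ (h : ℕ) (u v : List Bool), reach TStep h u v → gE none u v ≤ h
  | 0, u, v, r => by
    have : u = v := r
    subst this; simp [gE_self]
  | h + 1, u, v, ⟨w, s, r⟩ => by
    have h1 := gE_le_of_reach h w v r
    have h2 := gE_lip s none v
    omega

theorem TStep.ne' {u w : List Bool} (h : TStep u w) : u ≠ w := by
  cases h <;> simp

theorem TStep.length_eq' {u w : List Bool} (h : TStep u w) : u.length = w.length := by
  cases h <;> simp

theorem tildeDist_of_step {u w : List Bool} (h : TStep u w) : tildeDist u w = 1 := by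
  have hm : (1 : ℕ) ∈ {h | reach TStep h u w} := ⟨w, h, rfl⟩
  have h1 : tildeDist u w ≤ 1 := Nat.sInf_le hm
  have h2 : tildeDist u w ≠ 0 := by
    intro h0
    rcases Nat.sInf_eq_zero.mp h0 with h3 | h3
    · exact h.ne' h3
    · rw [h3] at hm; exact hm
  omega

theorem infix_two_iff (x y : Bool) : ∀ u : List Bool,
    (¬ [x, y] <:+: u) ↔ List.IsChain (fun a b => ¬ (a = x ∧ b = y)) u
  | [] => by simp
  | [a] => by
    simp only [List.isChain_singleton, iff_true]
    intro h; have := h.length_le; simp at this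
  | a :: b :: u => by
    rw [List.infix_cons_iff, List.isChain_cons_cons, ← infix_two_iff x y (b :: u)]
    simp [List.cons_prefix_cons]
    grind

/-- Free step. -/
def FS (f u w : List Bool) : Prop := TStep u w ∧ ¬ f <:+: u ∧ ¬ f <:+: w

theorem FS_reach_symm (f : List Bool) :
    ∀ {h : ℕ} {u v : List Bool}, reach (FS f) h u v → reach (FS f) h v u := by
  intro h
  induction h with
  | zero => intro u v r; exact r.symm
  | succ h ih =>
    intro u v r
    obtain ⟨w, s, rw⟩ := r
    exact reach_snoc (ih rw) ⟨s.1.symm, s.2.2, s.2.1⟩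

theorem FS_reach_TStep (f : List Bool) :
    ∀ {h : ℕ} {u v : List Bool}, reach (FS f) h u v → reach TStep h u v := by
  intro h
  induction h with
  | zero => intro u v r; exact r
  | succ h ih =>
    intro u v r
    obtain ⟨w, s, rw⟩ := r
    exact ⟨w, s.1, ih rw⟩

theorem reach_fun {step : List Bool → List Bool → Prop} :
    ∀ {h : ℕ} {u v : List Bool}, reach step h u v →
      ∃ w : ℕ → List Bool, w 0 = u ∧ w h = v ∧ ∀ k < h, step (w k) (w (k + 1)) := by
  intro h
  induction h with
  | zero => intro u v r; exact ⟨fun _ => u, rfl, r, by simp⟩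
  | succ h ih =>
    intro u v r
    obtain ⟨z, s, r⟩ := r
    obtain ⟨w, h0, h1, h2⟩ := ih r
    refine ⟨fun k => Nat.casesOn k u w, rfl, h1, ?_⟩
    intro k hk
    cases k with
    | zero => simpa [h0] using s
    | succ k => exact h2 k (by omega)

theorem first_mismatch : ∀ (u v : List Bool), u.length = v.length → u ≠ v →
    ∃ p a u' v', u = p ++ a :: u' ∧ v = p ++ (!a) :: v'
  | [], [], _, h => absurd rfl h
  | [], _ :: _, h, _ => by simp at h
  | _ :: _, [], h, _ => by simp at h
  | a :: u, c :: v, hl, hne => by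
    by_cases h : a = c
    · subst h
      obtain ⟨p, b, u', v', h1, h2⟩ := first_mismatch u v (by simpa using hl) (by simpa using hne)
      exact ⟨a :: p, b, u', v', by simp [h1], by simp [h2]⟩
    · exact ⟨[], a, u, v, rfl, by cases a <;> cases c <;> simp_all⟩

/-- One-step progress when the mismatch has the good orientation, `f = cc`. -/
theorem key_same (c : Bool) (p u' v' : List Bool) (hl : u'.length = v'.length)
    (hu : ¬ [c, c] <:+: p ++ (!c) :: u') (hv : ¬ [c, c] <:+: p ++ c :: v') :
    ∃ w, TStep (p ++ (!c) :: u') w ∧ (¬ [c, c] <:+: w) ∧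
      gE none w (p ++ c :: v') < gE none (p ++ (!c) :: u') (p ++ c :: v') := by
  rw [infix_two_iff] at hu hv
  rw [List.isChain_append] at hu hv
  obtain ⟨hp, hu, -⟩ := hu
  obtain ⟨-, hv, hpv⟩ := hv
  rcases u' with _ | ⟨b, u⟩
  · refine ⟨p ++ c :: [], by simpa using TStep.repl p [] (!c), ?_, ?_⟩
    · rw [infix_two_iff, List.isChain_append]
      exact ⟨hp, by simp, by simpa using hpv⟩
    · rw [gE_append, gE_append]; cases c <;> simp [gE]
  · rcases v' with _ | ⟨d, v⟩
    · simp at hl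
    have hd : d = !c := by
      have := hv.rel_head
      cases c <;> cases d <;> simp_all
    subst hd
    by_cases hb : b = c
    · subst hb
      refine ⟨p ++ b :: (!b) :: u, by simpa using TStep.swap p u (!b), ?_, ?_⟩
      · rw [infix_two_iff, List.isChain_append]
        refine ⟨hp, ?_, by simpa using hpv⟩
        rw [List.isChain_cons_cons]
        refine ⟨by simp, ?_⟩
        rw [List.isChain_cons_cons] at hu
        have := hu.2
        cases u with
        | nil => simp
        | cons e u => 
          rw [List.isChain_cons_cons] at this ⊢
          exact ⟨by simp, this.2⟩
      · rw [gE_append, gE_append]; cases b <;> simp [gE]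
    · have hb : b = !c := by cases c <;> cases b <;> simp_all
      subst hb
      refine ⟨p ++ c :: (!c) :: u, by simpa using TStep.repl p ((!c) :: u) (!c), ?_, ?_⟩
      · rw [infix_two_iff, List.isChain_append]
        refine ⟨hp, ?_, by simpa using hpv⟩
        rw [List.isChain_cons_cons] at hu ⊢
        exact ⟨by simp, hu.2⟩
      · rw [gE_append, gE_append]; cases c <;> simp [gE]

/-- One-step progress when the mismatch has the good orientation, `f = (!c)c`. -/
theorem key_diff (c : Bool) (p u' v' : List Bool) (hl : u'.length = v'.length)
    (hu : ¬ [!c, c] <:+: p ++ (!c) :: u') (hv : ¬ [!c, c] <:+: p ++ c :: v') :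
    ∃ w, TStep (p ++ (!c) :: u') w ∧ (¬ [!c, c] <:+: w) ∧
      gE none w (p ++ c :: v') < gE none (p ++ (!c) :: u') (p ++ c :: v') := by
  rw [infix_two_iff] at hu hv
  rw [List.isChain_append] at hu hv
  obtain ⟨hp, hu, -⟩ := hu
  obtain ⟨-, hv, hpv⟩ := hv
  refine ⟨p ++ c :: u', by simpa using TStep.repl p u' (!c), ?_, ?_⟩
  · rw [infix_two_iff, List.isChain_append]
    refine ⟨hp, ?_, by simpa using hpv⟩
    cases u' with
    | nil => simp
    | cons e u =>
      rw [List.isChain_cons_cons] at hu ⊢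
      exact ⟨by simp, hu.2⟩
  · rw [gE_append, gE_append]
    rcases u' with _ | ⟨b, u⟩
    · cases c <;> simp [gE]
    rcases v' with _ | ⟨d, v⟩
    · simp at hl
    have hb : b = !c := by
      have := hu.rel_head
      cases c <;> cases b <;> simp_all
    subst hb
    cases c <;> cases d <;> simp [gE]

theorem key (f : List Bool) (hf : f.length = 2) :
    ∃ c : Bool, ∀ (p u' v' : List Bool), u'.length = v'.length →
    (¬ f <:+: p ++ (!c) :: u') → (¬ f <:+: p ++ c :: v') →
    ∃ w, TStep (p ++ (!c) :: u') w ∧ (¬ f <:+: w) ∧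
      gE none w (p ++ c :: v') < gE none (p ++ (!c) :: u') (p ++ c :: v') := by
  rcases f with _ | ⟨x, _ | ⟨c, _ | ⟨z, f⟩⟩⟩ <;> simp at hf
  refine ⟨c, ?_⟩
  by_cases h : x = c
  · subst h; exact key_same x
  · have : x = !c := by cases x <;> cases c <;> simp_all
    subst this; exact key_diff c

theorem main_reach (f : List Bool) (hf : f.length = 2) : ∀ (n : ℕ) (u v : List Bool),
    u.length = v.length → (¬ f <:+: u) → (¬ f <:+: v) → gE none u v ≤ n →
    ∃ h ≤ n, reach (FS f) h u v := by
  obtain ⟨c, hc⟩ := key f hf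
  intro n
  induction n with
  | zero =>
    intro u v hl hu hv hE
    refine ⟨0, le_rfl, ?_⟩
    by_contra hne
    obtain ⟨p, a, u', v', rfl, rfl⟩ := first_mismatch u v hl hne
    have hl' : u'.length = v'.length := by simpa using hl
    by_cases ha : a = c
    · subst ha
      obtain ⟨w, -, -, h⟩ := hc p v' u' hl'.symm hv hu
      rw [gE_symm] at hE; omega
    · have : a = !c := by cases a <;> cases c <;> simp_all
      subst this
      rw [Bool.not_not] at *
      obtain ⟨w, -, -, h⟩ := hc p u' v' hl' hu hv
      omega
  | succ n ih =>
    intro u v hl hu hv hE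
    by_cases hne : u = v
    · exact ⟨0, by omega, hne⟩
    obtain ⟨p, a, u', v', rfl, rfl⟩ := first_mismatch u v hl hne
    have hl' : u'.length = v'.length := by simpa using hl
    by_cases ha : a = c
    · subst ha
      obtain ⟨w, h1, h2, h3⟩ := hc p v' u' hl'.symm hv hu
      rw [gE_symm] at hE
      obtain ⟨h, hh, r⟩ := ih w _ (h1.length_eq'.symm.trans hl.symm) h2 hu (by omega)
      exact ⟨h + 1, by omega, FS_reach_symm f ⟨w, ⟨h1, hv, h2⟩, r⟩⟩
    · have : a = !c := by cases a <;> cases c <;> simp_all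
      subst this
      rw [Bool.not_not] at *
      obtain ⟨w, h1, h2, h3⟩ := hc p u' v' hl' hu hv
      obtain ⟨h, hh, r⟩ := ih w _ (h1.length_eq'.symm.trans hl) h2 hv (by omega)
      exact ⟨h + 1, by omega, ⟨w, ⟨h1, hu, h2⟩, r⟩⟩

/-- Every binary word of length `2` is tilde-isometric. -/
theorem tildeIsometric_of_length_two (f : List Bool) (h : f.length = 2) :
    TildeIsometric f := by
  intro n _ u v hu hv fu fv
  obtain ⟨m, hm, r⟩ := main_reach f h _ u v (hu.trans hv.symm) fu fv le_rfl
  have hmem : m ∈ {h | reach TStep h u v} := FS_reach_TStep f r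
  have h1 : tildeDist u v ≤ m := Nat.sInf_le hmem
  have h2 : reach TStep (tildeDist u v) u v := Nat.sInf_mem ⟨m, hmem⟩
  have h3 := gE_le_of_reach _ _ _ h2
  have h4 : tildeDist u v = m := by omega
  rw [h4]
  obtain ⟨w, w0, w1, w2⟩ := reach_fun r
  refine ⟨w, w0, w1, fun k hk => tildeDist_of_step (w2 k hk).1, ?_⟩
  intro k hk
  cases k with
  | zero => rw [w0]; exact fu
  | succ k => exact (w2 k hk).2.2
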